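/- For every non-negative integer m, the following identity holds in the field of rational functions Q(q, a, x): ∑_{k=0}^{2m} (q^{-2m};q)_k (a;q)_k (x;q)_k q^k / ((q;q)_k (x^2;q)_k) = a^m · ∑_{k=0}^{m} (q^{-m};q)_k (x q^m;q)_k (a;q)_k (x^2/a;q)_k q^k / ((q;q)_k (x^2 q;q^2)_k (-x;q)_k). -/

import Mathlib

open Finset

/-- The q-Pochhammer symbol `(a;q)_n = ∏_{j=0}^{n-1} (1 - a q^j)`. -/
noncomputable def qPoch {F : Type*} [Field F] (q a : F) (n : ℕ) : F :=
  ∏ j ∈ Finset.range n, (1 - a * q ^ j)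

/-- The field of rational functions `ℚ(q, a, x)`. -/
abbrev F3 : Type := FractionRing (MvPolynomial (Fin 3) ℚ)

noncomputable def q : F3 := algebraMap (MvPolynomial (Fin 3) ℚ) F3 (MvPolynomial.X 0)
noncomputable def a : F3 := algebraMap (MvPolynomial (Fin 3) ℚ) F3 (MvPolynomial.X 1)
noncomputable def x : F3 := algebraMap (MvPolynomial (Fin 3) ℚ) F3 (MvPolynomial.X 2)


section aux
variable {F : Type*} [Field F]

lemma qP_zero (t c : F) : qPoch t c 0 = 1 := by simp [qPoch]

lemma qP_succ (t c : F) (n : ℕ) : qPoch t c (n+1) = qPoch t c n * (1 - c * t ^ n) := by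
  simp [qPoch, Finset.prod_range_succ]

lemma qP_shift (t c : F) (n : ℕ) : (1 - c) * qPoch t (c * t) n = qPoch t c n * (1 - c * t ^ n) := by
  induction n with
  | zero => simp [qP_zero]
  | succ n ih =>
    rw [qP_succ, qP_succ, ← mul_assoc, ih]; ring

lemma qP_shift' (t c : F) (n : ℕ) (h : 1 - c ≠ 0) :
    qPoch t (c * t) n = qPoch t c n * (1 - c * t ^ n) / (1 - c) := by
  rw [eq_div_iff h, ← qP_shift]; ring

lemma qP_vanish (t : F) (ht : t ≠ 0) (n k : ℕ) (h : n < k) : qPoch t ((t ^ n)⁻¹) k = 0 := by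
  unfold qPoch
  apply Finset.prod_eq_zero (Finset.mem_range.mpr h)
  rw [inv_mul_cancel₀ (pow_ne_zero _ ht), sub_self]

lemma tele (t z : F) (φ A e b : ℕ → F)
    (hφ : ∀ k, φ (k+1) = (b k - t ^ k * z) * φ k)
    (h0 : A 0 = b 0 * e 0)
    (h : ∀ k, A (k+1) * t ^ (k+1) + t * e k = b (k+1) * e (k+1)) (N : ℕ) :
    t ^ N * ∑ k ∈ range (N+1), (A k - z * e k) * φ k = e N * φ (N+1) := by
  induction N with
  | zero => simp [hφ, h0]; ring
  | succ N ih =>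
    rw [Finset.sum_range_succ, mul_add, pow_succ', mul_assoc, ih, hφ (N+1)]
    linear_combination φ (N+1) * h N

/-- coefficients -/
noncomputable def cp (t y : F) (n k : ℕ) : F :=
  qPoch t ((t ^ n)⁻¹) k * qPoch t y k * t ^ k / (qPoch t t k * qPoch t (y ^ 2) k)

noncomputable def cr (t y : F) (m k : ℕ) : F :=
  qPoch t ((t ^ m)⁻¹) k * qPoch t (y * t ^ m) k * t ^ k /
    (qPoch t t k * qPoch (t ^ 2) (y ^ 2 * t) k * qPoch t (-y) k)

noncomputable def cs (t y : F) (m k : ℕ) : F :=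
  qPoch t ((t ^ m)⁻¹) k * qPoch t (y * t ^ (m+1)) k * t ^ k /
    (qPoch t t k * qPoch (t ^ 2) (y ^ 2 * t) k * qPoch t (-y) (k+1))

structure Gen (t y : F) : Prop where
  t0 : t ≠ 0
  t1 : ∀ n : ℕ, 1 - t ^ (n+1) ≠ 0
  y2 : ∀ n : ℕ, 1 - y ^ 2 * t ^ n ≠ 0

variable {t y : F}

lemma Gen.ym (g : Gen t y) (n : ℕ) : 1 - y * t ^ n ≠ 0 := by
  intro h
  apply g.y2 (2 * n)
  linear_combination (1 + y * t ^ n) * h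

lemma Gen.yp (g : Gen t y) (n : ℕ) : 1 + y * t ^ n ≠ 0 := by
  intro h
  apply g.y2 (2 * n)
  linear_combination (1 - y * t ^ n) * h

lemma Gen.ti (g : Gen t y) (n : ℕ) : 1 - (t ^ (n+1))⁻¹ ≠ 0 := by
  intro h
  apply g.t1 n
  have := g.t0
  field_simp at h
  linear_combination -h

lemma inv_shift (ht : t ≠ 0) (n : ℕ) : (t ^ n)⁻¹ = (t ^ (n+1))⁻¹ * t := by
  field_simp
  ring

lemma sh1 (g : Gen t y) (n k : ℕ) : qPoch t ((t ^ n)⁻¹) k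
    = qPoch t ((t ^ (n+1))⁻¹) k * (t ^ (n+1) - t ^ k) / (t ^ (n+1) - 1) := by
  have h1 := g.t1 n
  have h3 : t ^ (n+1) - 1 ≠ 0 := by
    intro h; apply h1; linear_combination -h
  have h2 := g.t0
  rw [inv_shift h2 n, qP_shift' _ _ _ (g.ti n)]
  have h4 := g.ti n
  have h5 : t ^ (n+1) ≠ 0 := pow_ne_zero _ h2
  rw [div_eq_div_iff h4 h3]
  generalize t ^ (n+1) = w at *
  field_simp

lemma sh2 (g : Gen t y) (n k : ℕ) : qPoch t (y * t ^ (n+1)) k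
    = qPoch t (y * t ^ n) k * (1 - y * t ^ n * t ^ k) / (1 - y * t ^ n) := by
  rw [pow_succ, ← mul_assoc, qP_shift' _ _ _ (g.ym n)]

lemma cp_one (g : Gen t y) (n k : ℕ) :
    cp t y n k = cp t y (n+1) k * (t ^ (n+1) - t ^ k) / (t ^ (n+1) - 1) := by
  unfold cp; rw [sh1 g n k]; ring

lemma cp_step (g : Gen t y) (n k : ℕ) :
    cp t y n (k+1) = cp t y n k * ((t ^ n - t ^ k) * (1 - y * t ^ k) * t) /
      (t ^ n * ((1 - t ^ (k+1)) * (1 - y^2 * t ^ k))) := by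
  unfold cp
  have h := pow_ne_zero n g.t0
  have : 1 - (t^n)⁻¹ * t ^ k = (t ^ n - t ^ k) / t ^ n := by field_simp
  simp only [qP_succ, this]
  rw [pow_succ' t k]
  simp only [div_eq_mul_inv, mul_inv]
  ring

lemma pow_sub_one_ne (g : Gen t y) (n : ℕ) : t ^ (n+1) - 1 ≠ 0 := by
  intro h; apply g.t1 n; linear_combination -h

lemma cp_zero (n : ℕ) : cp t y n 0 = 1 := by simp [cp, qP_zero]

lemma cp_rec (g : Gen t y) (n k : ℕ) :
    ((1 - y^2 * t ^ (n+1)) * cp t y (n+2) (k+1) - y * (1 - y * t^(n+1)) * cp t y (n+1) (k+1)) * t ^ (k+1)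
    + t * ((1 - y * t^(n+1)) * cp t y (n+1) k - (1 - t^(n+1)) * y * cp t y n k)
    = (1 - y * t^(n+1)) * cp t y (n+1) (k+1) - (1 - t^(n+1)) * y * cp t y n (k+1) := by
  rw [cp_one g n k, cp_one g n (k+1), cp_one g (n+1) k, cp_one g (n+1) (k+1), cp_step g (n+2) k]
  have a1 := pow_sub_one_ne g n
  have a2 := pow_sub_one_ne g (n+1)
  have a3 := g.t1 k
  have a4 := g.y2 k
  have a5 := g.t0
  have a6 := pow_ne_zero n g.t0
  generalize cp t y (n+2) k = c
  have e1 : t ^ (n+1) = t ^ n * t := by ring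
  have e2 : t ^ (n+1+1) = t ^ n * t^2 := by ring
  have e2' : t ^ (n+2) = t ^ n * t^2 := by ring
  have e3 : t ^ (k+1) = t ^ k * t := by ring
  simp only [e1, e2, e3] at *
  clear e1 e2 e2' e3
  generalize t ^ n = w at *
  generalize t ^ k = v at *
  have b1 : 1 - t * v ≠ 0 := by rwa [mul_comm]
  have b2 : 1 - v * y ^ 2 ≠ 0 := by rwa [mul_comm]
  have b3 : t * w - 1 ≠ 0 := by rwa [mul_comm]
  have b4 : t ^ 2 * w - 1 ≠ 0 := by rwa [mul_comm]
  field_simp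
  ring

lemma cr_one (g : Gen t y) (m k : ℕ) :
    cr t y (m+1) k = qPoch t ((t ^ (m+1))⁻¹) k * qPoch t (y * t ^ m) k * t ^ k /
    (qPoch t t k * qPoch (t ^ 2) (y ^ 2 * t) k * qPoch t (-y) k)
      * ((1 - y * t ^ m * t ^ k) / (1 - y * t ^ m)) := by
  unfold cr; rw [sh2 g m k]; ring

lemma cr_cs (g : Gen t y) (m k : ℕ) :
    cs t y m k = cr t y m k * ((1 - y * t ^ m * t ^ k) / ((1 - y * t ^ m) * (1 + y * t ^ k))) := by
  unfold cr cs; rw [sh2 g m k, qP_succ]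
  have : 1 - -y * t ^ k = 1 + y * t ^ k := by ring
  rw [this]
  simp only [div_eq_mul_inv, mul_inv]
  ring

/-- shift of `cr` -/
lemma cr_up (g : Gen t y) (m k : ℕ) :
    cr t y m k * ((1 - y * t ^ m * t ^ k) * (t ^ (m+1) - 1)) 
      = cr t y (m+1) k * ((t ^ (m+1) - t ^ k) * (1 - y * t ^ m)) := by
  rw [cr_one g]
  unfold cr
  rw [sh1 g m k]
  have a1 := pow_sub_one_ne g m
  have a2 := g.ym m
  generalize (qPoch t t k * qPoch (t ^ 2) (y ^ 2 * t) k * qPoch t (-y) k) = d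
  simp only [div_eq_mul_inv]
  generalize d⁻¹ = d'
  field_simp

lemma cs_up (g : Gen t y) (m k : ℕ) :
    cs t y m k = cr t y (m+1) k * ((t ^ (m+1) - t ^ k) / ((t ^ (m+1) - 1) * (1 + y * t ^ k))) := by
  rw [cr_cs g]
  have a1 := pow_sub_one_ne g m
  have a2 := g.ym m
  have a3 := g.yp k
  have h := cr_up g m k
  field_simp
  linear_combination h

lemma first_rec (g : Gen t y) (m k : ℕ) :
    (1 - y^2 * t^(2*m+2)) * cs t y (m+1) k = (1 - y * t^(2*m+2)) * cr t y (m+1) k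
      - (1 - t^(2*m+2)) * y * cs t y m k := by
  rw [cs_up g m k, cr_cs g (m+1) k]
  have a1 := pow_sub_one_ne g m
  have a2 := g.ym (m+1)
  have a3 := g.yp k
  have e : t ^ (2*m+2) = (t ^ (m+1))^2 := by ring
  rw [e]
  generalize t ^ (m+1) = w at *
  generalize t ^ k = v at *
  field_simp
  ring

/-- common factor -/
noncomputable def cc (t y : F) (m k : ℕ) : F :=
  qPoch t ((t ^ (m+1))⁻¹) k * qPoch t (y * t ^ m) k * t ^ k /
    (qPoch t t k * qPoch (t ^ 2) (y ^ 2 * t) k * qPoch t (-y) k)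

lemma cc_step (g : Gen t y) (m k : ℕ) :
    cc t y m (k+1) = cc t y m k * ((t ^ (m+1) - t ^ k) * (1 - y * t ^ m * t ^ k) * t) /
      (t ^ (m+1) * ((1 - t ^ (k+1)) * (1 - y^2 * (t ^ k)^2 * t) * (1 + y * t ^ k))) := by
  unfold cc
  have h := pow_ne_zero (m+1) g.t0
  have : 1 - (t^(m+1))⁻¹ * t ^ k = (t ^ (m+1) - t ^ k) / t ^ (m+1) := by field_simp
  have h2 : 1 - -y * t ^ k = 1 + y * t ^ k := by ring
  have h3 : 1 - y^2 * t * (t ^ 2) ^ k = 1 - y^2 * (t ^ k)^2 * t := by ring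
  simp only [qP_succ, this, h2, h3]
  rw [pow_succ' t k]
  simp only [div_eq_mul_inv, mul_inv]
  ring

lemma cr_cc (g : Gen t y) (m k : ℕ) :
    cr t y m k = cc t y m k * (t ^ (m+1) - t ^ k) / (t ^ (m+1) - 1) := by
  unfold cr cc; rw [sh1 g m k]; ring

lemma second_rec (g : Gen t y) (m k : ℕ) :
    ((1 - y^2 * t^(2*m+1)) * cr t y (m+1) (k+1) - (1 - y * t^(2*m+1)) * (2 * y) * cs t y m (k+1)
      + (1 - t^(2*m+1)) * y * cr t y m (k+1)) * t ^ (k+1)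
    + t * ((1 - y * t^(2*m+1)) * cs t y m k)
    = (1 + y^2 * (t^(k+1))^2) * ((1 - y * t^(2*m+1)) * cs t y m (k+1)) := by
  rw [cs_up g m k, cs_up g m (k+1), cr_one g m k, cr_one g m (k+1), cr_cc g m (k+1)]
  rw [← cc, ← cc, cc_step g]
  have a1 := pow_sub_one_ne g m
  have a2 := g.ym m
  have a3 := g.yp k
  have a3' := g.yp (k+1)
  have a4 := g.t1 k
  have a5 := g.t0
  have a6 := pow_ne_zero m g.t0
  have a7 : 1 - y^2 * (t ^ k)^2 * t ≠ 0 := by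
    have := g.y2 (2*k+1)
    intro h; apply this; linear_combination h
  have e : t ^ (2*m+1) = (t ^ m)^2 * t := by ring
  rw [e]
  generalize cc t y m k = c
  have e1 : t ^ (m+1) = t ^ m * t := by ring
  have e3 : t ^ (k+1) = t ^ k * t := by ring
  simp only [e1, e3] at *
  clear e e1 e3
  generalize t ^ m = w at *
  generalize t ^ k = v at *
  have b1 : 1 - t * v ≠ 0 := by rwa [mul_comm]
  have b3 : t * w - 1 ≠ 0 := by rwa [mul_comm]
  have b4 : 1 + y * v * t ≠ 0 := by rwa [mul_assoc]
  have b5 : 1 + y * t * v ≠ 0 := by rwa [mul_assoc, mul_comm t v]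
  have b6 : 1 + t * v * y ≠ 0 := by rwa [mul_comm, mul_comm t v]
  have b7 : 1 + t * y * v ≠ 0 := by rwa [mul_comm t y]
  have b8 : 1 - y ^ 2 * t * v ^ 2 ≠ 0 := by rwa [mul_right_comm]
  have b9 : 1 - t * y ^ 2 * v ^ 2 ≠ 0 := by rwa [mul_comm t]
  field_simp
  ring

lemma cr_zero (m : ℕ) : cr t y m 0 = 1 := by simp [cr, qP_zero]
lemma cs_zero (m : ℕ) : cs t y m 0 = 1 / (1 + y) := by simp [cs, qP_zero, qP_succ]

noncomputable def SP (t y z : F) (n : ℕ) : F := ∑ k ∈ range (n+1), cp t y n k * qPoch t z k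
noncomputable def SR (t y z : F) (n : ℕ) : F :=
  ∑ k ∈ range (n+1), cr t y n k * (qPoch t z k * qPoch t (y^2 / z) k)
noncomputable def SS (t y z : F) (n : ℕ) : F :=
  ∑ k ∈ range (n+1), cs t y n k * (qPoch t z k * qPoch t (y^2 / z) k)

lemma cp_v (g : Gen t y) {n k : ℕ} (h : n < k) : cp t y n k = 0 := by
  simp [cp, qP_vanish t g.t0 n k h]
lemma cr_v (g : Gen t y) {n k : ℕ} (h : n < k) : cr t y n k = 0 := by
  simp [cr, qP_vanish t g.t0 n k h]
lemma cs_v (g : Gen t y) {n k : ℕ} (h : n < k) : cs t y n k = 0 := by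
  simp [cs, qP_vanish t g.t0 n k h]

lemma ext_sum (c φ : ℕ → F) (n N : ℕ) (h : n ≤ N) (hc : ∀ k, n < k → c k = 0) :
    ∑ k ∈ range (n+1), c k * φ k = ∑ k ∈ range (N+1), c k * φ k := by
  apply Finset.sum_subset
  · intro k; simp; omega
  · intro k _ h2
    rw [hc k (by simpa using h2), zero_mul]

lemma SP_ext (g : Gen t y) (z : F) (n N : ℕ) (h : n ≤ N) :
    SP t y z n = ∑ k ∈ range (N+1), cp t y n k * qPoch t z k :=
  ext_sum _ _ n N h (fun _ hk => cp_v g hk)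
lemma SR_ext (g : Gen t y) (z : F) (n N : ℕ) (h : n ≤ N) :
    SR t y z n = ∑ k ∈ range (N+1), cr t y n k * (qPoch t z k * qPoch t (y^2 / z) k) :=
  ext_sum _ (fun k => qPoch t z k * qPoch t (y^2 / z) k) n N h (fun _ hk => cr_v g hk)
lemma SS_ext (g : Gen t y) (z : F) (n N : ℕ) (h : n ≤ N) :
    SS t y z n = ∑ k ∈ range (N+1), cs t y n k * (qPoch t z k * qPoch t (y^2 / z) k) :=
  ext_sum _ (fun k => qPoch t z k * qPoch t (y^2 / z) k) n N h (fun _ hk => cs_v g hk)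

lemma SP_rec (g : Gen t y) (z : F) (n : ℕ) :
    (1 - y^2 * t^(n+1)) * SP t y z (n+2) = (z + y) * (1 - y * t^(n+1)) * SP t y z (n+1)
      - (1 - t^(n+1)) * z * y * SP t y z n := by
  have T := tele t z (fun k => qPoch t z k)
    (fun k => (1 - y^2 * t ^ (n+1)) * cp t y (n+2) k - y * (1 - y * t^(n+1)) * cp t y (n+1) k)
    (fun k => (1 - y * t^(n+1)) * cp t y (n+1) k - (1 - t^(n+1)) * y * cp t y n k)
    (fun _ => 1) (fun k => by simp only [qP_succ]; ring)
    (by simp only [cp_zero]; ring)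
    (fun k => by rw [one_mul]; exact cp_rec g n k) (n+2)
  simp only [cp_v g (show n+1 < n+2 by omega), cp_v g (show n < n+2 by omega)] at T
  simp only [mul_zero, sub_zero, zero_mul] at T
  have T2 := (mul_eq_zero.mp T).resolve_left (pow_ne_zero _ g.t0)
  rw [SP_ext g z n (n+2) (by omega), SP_ext g z (n+1) (n+2) (by omega), SP,
    ← sub_eq_zero, ← T2]
  simp only [Finset.mul_sum, ← Finset.sum_sub_distrib]
  apply Finset.sum_congr rfl
  intros; ring

lemma SS_rec (g : Gen t y) (z : F) (m : ℕ) :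
    (1 - y^2 * t^(2*m+2)) * SS t y z (m+1) = (1 - y * t^(2*m+2)) * SR t y z (m+1)
      - (1 - t^(2*m+2)) * y * SS t y z m := by
  rw [SS_ext g z m (m+1) (by omega), SS, SR]
  simp only [Finset.mul_sum, ← Finset.sum_sub_distrib]
  apply Finset.sum_congr rfl
  intro k _
  linear_combination (qPoch t z k * qPoch t (y^2 / z) k) * first_rec g m k

lemma SR_rec (g : Gen t y) (z : F) (hz : z ≠ 0) (m : ℕ) :
    (1 - y^2 * t^(2*m+1)) * SR t y z (m+1) =
      (z + 2 * y + y^2/z) * (1 - y * t^(2*m+1)) * SS t y z m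
      - (1 - t^(2*m+1)) * y * SR t y z m := by
  have T := tele t (z + y^2/z) (fun k => qPoch t z k * qPoch t (y^2 / z) k)
    (fun k => (1 - y^2 * t^(2*m+1)) * cr t y (m+1) k - (1 - y * t^(2*m+1)) * (2 * y) * cs t y m k
      + (1 - t^(2*m+1)) * y * cr t y m k)
    (fun k => (1 - y * t^(2*m+1)) * cs t y m k)
    (fun k => 1 + y^2 * (t^k)^2) (fun k => by simp only [qP_succ]; field_simp; ring)
    (by
      have := g.yp 0
      rw [pow_zero, mul_one] at this
      simp only [cr_zero, cs_zero]; field_simp; ring)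
    (fun k => second_rec g m k) (m+1)
  simp only [cs_v g (show m < m+1 by omega)] at T
  simp only [mul_zero, zero_mul] at T
  have T2 := (mul_eq_zero.mp T).resolve_left (pow_ne_zero _ g.t0)
  rw [SR_ext g z m (m+1) (by omega), SS_ext g z m (m+1) (by omega), SR,
    ← sub_eq_zero, ← T2]
  simp only [Finset.mul_sum, ← Finset.sum_sub_distrib]
  apply Finset.sum_congr rfl
  intros; ring

lemma main_gen (g : Gen t y) (z : F) (hz : z ≠ 0) (m : ℕ) :
    SP t y z (2*m) = z^m * SR t y z m ∧ SP t y z (2*m+1) = (z + y) * z^m * SS t y z m := by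
  induction m with
  | zero =>
    have h1 := g.yp 0
    have h2 := g.ym 0
    have h3 := g.t1 0
    have h4 := g.y2 0
    have h5 := g.t0
    simp only [pow_zero, mul_one, zero_add, pow_one] at h1 h2 h3 h4
    constructor
    · simp [SP, SR, cp_zero, cr_zero, qP_zero]
    · simp only [SP, SS, Finset.sum_range_succ, Finset.sum_range_zero, mul_zero, zero_add, cp_zero,
        cs_zero, qP_zero]
      rw [show (1:ℕ) = 0 + 1 from rfl, cp_step g, cp_zero]
      simp only [qP_succ, qP_zero, pow_zero, zero_add, pow_one, mul_one, one_mul]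
      field_simp
      ring
  | succ m ih =>
    obtain ⟨i1, i2⟩ := ih
    have e : SP t y z (2*(m+1)) = z^(m+1) * SR t y z (m+1) := by
      have r := SP_rec g z (2*m)
      rw [i1, i2] at r
      have r2 := SR_rec g z hz m
      apply mul_left_cancel₀ (g.y2 (2*m+1))
      rw [show 2*(m+1) = 2*m+2 by ring, r]
      rw [mul_left_comm (1 - y ^ 2 * t ^ (2 * m + 1)) (z ^ (m+1)), r2]
      field_simp
      ring
    refine ⟨e, ?_⟩
    have r := SP_rec g z (2*m+1)
    rw [show 2*m+1+1 = 2*(m+1) by ring, e, i2] at r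
    have r2 := SS_rec g z m
    apply mul_left_cancel₀ (g.y2 (2*m+2))
    rw [show 2*(m+1)+1 = 2*m+1+2 by ring]
    rw [show 2*(m+1) = 2*m+2 by ring] at r
    rw [r]
    linear_combination -(z+y) * z^(m+1) * r2

end aux

lemma F3_ne (p : MvPolynomial (Fin 3) ℚ) (h : MvPolynomial.eval (fun _ => (0:ℚ)) p ≠ 0) :
    algebraMap (MvPolynomial (Fin 3) ℚ) F3 p ≠ 0 := by
  intro h0
  apply h
  rw [(IsFractionRing.injective (MvPolynomial (Fin 3) ℚ) F3) (h0.trans (map_zero _).symm)]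
  simp

lemma gen_qx : Gen q x where
  t0 := by
    unfold q
    intro h0
    exact MvPolynomial.X_ne_zero (R := ℚ) (0 : Fin 3)
      ((IsFractionRing.injective (MvPolynomial (Fin 3) ℚ) F3) (h0.trans (map_zero _).symm))
  t1 n := by
    have := F3_ne (1 - MvPolynomial.X 0 ^ (n+1)) (by simp)
    simpa [q] using this
  y2 n := by
    have := F3_ne (1 - MvPolynomial.X 2 ^ 2 * MvPolynomial.X 0 ^ n) (by simp)
    simpa [q, x] using this

lemma a_ne : a ≠ 0 := by
  unfold a
  intro h0
  exact MvPolynomial.X_ne_zero (R := ℚ) (1 : Fin 3)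
    ((IsFractionRing.injective (MvPolynomial (Fin 3) ℚ) F3) (h0.trans (map_zero _).symm))

theorem q_Clausen_sqrt (m : ℕ) :
    ∑ k ∈ Finset.range (2 * m + 1),
        qPoch q ((q ^ (2 * m))⁻¹) k * qPoch q a k * qPoch q x k * q ^ k /
          (qPoch q q k * qPoch q (x ^ 2) k) =
    a ^ m * ∑ k ∈ Finset.range (m + 1),
        qPoch q ((q ^ m)⁻¹) k * qPoch q (x * q ^ m) k * qPoch q a k *
          qPoch q (x ^ 2 / a) k * q ^ k /
          (qPoch q q k * qPoch (q ^ 2) (x ^ 2 * q) k * qPoch q (-x) k) := by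
  have h := (main_gen gen_qx a a_ne m).1
  unfold SP SR cp cr at h
  calc _ = _ := ?_
    _ = _ := h
    _ = _ := ?_
  · apply Finset.sum_congr rfl
    intro k _
    ring
  · congr 1
    apply Finset.sum_congr rfl
    intro k _
    ring
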